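/- For every i ≥ 1, running gradient descent with the i-th order silver stepsize schedule s̄_i = (α_1,…,α_{2^i−1}) on any convex differentiable f: ℝ^d → ℝ with 1-Lipschitz gradient and minimizer x*, starting from any x_1 and setting x_{j+1} = x_j − α_j ∇f(x_j), yields f(x_{2^i}) − f(x*) ≤ ‖x_1 − x*‖²/(2(ρ^i − 1)), where ρ = 1 + √2. In particular, the last iterate after T = 2^i − 1 steps has suboptimality O(‖x_1 − x*‖²/(T+1)^{log₂ρ}). -/

import Mathlib

open Finset
open scoped RealInnerProductSpace

noncomputable section

/-- Gradient-descent trajectory along a finite list of stepsizes. -/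
def gdIter {E : Type*} [AddCommGroup E] [SMul ℝ E] (g : E → E) : E → List ℝ → E
  | x, [] => x
  | x, a :: L => gdIter g (x - a • g x) L

/-- A finite stepsize schedule (of positive reals) is primitive if the key
gradient-descent inequality holds for every smooth convex problem instance. -/
def IsPrimitive (L : List ℝ) : Prop :=
  (∀ a ∈ L, (0:ℝ) < a) ∧
  ∀ (d : ℕ) (f : EuclideanSpace ℝ (Fin d) → ℝ)
    (g : EuclideanSpace ℝ (Fin d) → EuclideanSpace ℝ (Fin d)),
    ConvexOn ℝ Set.univ f →
    (∀ y, HasGradientAt f (g y) y) →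
    LipschitzWith 1 g →
    ∀ xstar : EuclideanSpace ℝ (Fin d), IsMinOn f Set.univ xstar →
    ∀ x1 : EuclideanSpace ℝ (Fin d),
      L.sum * (f (gdIter g x1 L) - f xstar)
        + (L.sum * (L.sum + 1) / 2) * ‖g (gdIter g x1 L)‖ ^ 2
        + 2⁻¹ * ‖gdIter g x1 L - xstar‖ ^ 2
      ≤ 2⁻¹ * ‖x1 - xstar‖ ^ 2
        + ∑ i : Fin L.length,
            L.get i *
              (f (gdIter g x1 (L.take i.1)) - f xstar
                - ⟪g (gdIter g x1 (L.take i.1)), gdIter g x1 (L.take i.1) - xstar⟫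
                + 2⁻¹ * ‖g (gdIter g x1 (L.take i.1))‖ ^ 2)

/-- The join-stepsize function. -/
def phi (x y : ℝ) : ℝ :=
  (-(x + y) + Real.sqrt ((x + y + 2) ^ 2 + 4 * (x + 1) * (y + 1))) / 2

/-- Concatenation of two stepsize schedules with the join stepsize in between. -/
def concatSched (s r : List ℝ) : List ℝ := s ++ phi s.sum r.sum :: r

/-- The silver stepsize schedules. -/
def silver : ℕ → List ℝ
  | 0 => []
  | i + 1 => concatSched (silver i) (silver i)

/-- Recursive concatenation of a sequence of schedules. -/
def concatAll (s : ℕ → List ℝ) : ℕ → List ℝ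
  | 0 => []
  | i + 1 => concatSched (concatAll s i) (s (i + 1))

/-- The number of copies of the `j`-th silver schedule. -/
def kSeq (c : ℝ) (j : ℕ) : ℕ := ⌊2 * (2:ℝ) ^ (c * j)⌋₊

def MSeq (c : ℝ) (j : ℕ) : ℕ := ∑ j' ∈ Finset.Icc 1 j, kSeq c j'

/-- The block index `j` of `i`, i.e. the `j` with `M_{j-1} < i ≤ M_j`. -/
def blockIdx (c : ℝ) (i : ℕ) : ℕ := sInf {j | i ≤ MSeq c j}

/-- The partially concatenated schedules `ŝ_i`. -/
def shatSched (c : ℝ) : ℕ → List ℝ := concatAll fun i => silver (blockIdx c i)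

/-- The `t`-th entry (1-indexed) of the infinite limiting schedule `ŝ`. -/
def shatEntry (c : ℝ) (t : ℕ) : ℝ := (shatSched c t).getD (t - 1) 0

section Composition

variable {E : Type*} [NormedAddCommGroup E] [InnerProductSpace ℝ E]

/-- The interpolation inequality of convex functions `f` with `1`-Lipschitz gradient `g`. -/
def Interpolable (f : E → ℝ) (g : E → E) : Prop :=
  ∀ x y, f y + ⟪g y, x - y⟫ + 2⁻¹ * ‖g x - g y‖ ^ 2 ≤ f x

/-- The weighted sum, along gradient descent from `x` with stepsizes `L`, of the gaps
`f xᵢ - F - ⟪g xᵢ, xᵢ - w⟫ + ‖g xᵢ‖² / 2`. -/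
def gapSum (f : E → ℝ) (g : E → E) (w : E) (F : ℝ) : E → List ℝ → ℝ
  | _, [] => 0
  | x, a :: L =>
      a * (f x - F - ⟪g x, x - w⟫ + 2⁻¹ * ‖g x‖ ^ 2) + gapSum f g w F (x - a • g x) L

/-- The inequality of a primitive schedule for a fixed problem instance, with an arbitrary
reference point `w` and reference value `F` in place of a minimizer and the minimum. -/
def PrimitiveFor (f : E → ℝ) (g : E → E) (L : List ℝ) : Prop :=
  ∀ (w : E) (F : ℝ) (x : E),
    L.sum * (f (gdIter g x L) - F)
        + L.sum * (L.sum + 1) / 2 * ‖g (gdIter g x L)‖ ^ 2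
        + 2⁻¹ * ‖gdIter g x L - w‖ ^ 2
      ≤ 2⁻¹ * ‖x - w‖ ^ 2 + gapSum f g w F x L

theorem gdIter_append (g : E → E) (s r : List ℝ) (x : E) :
    gdIter g x (s ++ r) = gdIter g (gdIter g x s) r := by
  induction s generalizing x with
  | nil => rfl
  | cons a s ih => exact ih _

theorem gapSum_append (f : E → ℝ) (g : E → E) (w : E) (F : ℝ) (s r : List ℝ) (x : E) :
    gapSum f g w F x (s ++ r) =
      gapSum f g w F x s + gapSum f g w F (gdIter g x s) r := by
  induction s generalizing x with
  | nil => simp [gapSum, gdIter]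
  | cons a s ih => simp only [List.cons_append, gapSum, gdIter, ih, add_assoc]

variable {f : E → ℝ} {g : E → E}

theorem Interpolable.gapSum_nonpos (h : Interpolable f g) {L : List ℝ}
    (hL : ∀ a ∈ L, 0 < a) (v x : E) :
    gapSum f g (v - g v) (f v - 2⁻¹ * ‖g v‖ ^ 2) x L ≤ 0 := by
  induction L generalizing x with
  | nil => exact le_rfl
  | cons a L ih =>
    have hrest := ih (fun b hb => hL b (List.mem_cons_of_mem a hb)) (x - a • g x)
    have hv := h v x
    have hgap : f x - (f v - 2⁻¹ * ‖g v‖ ^ 2) - ⟪g x, x - (v - g v)⟫ + 2⁻¹ * ‖g x‖ ^ 2 ≤ 0 := by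
      rw [norm_sub_sq_real, real_inner_comm] at hv
      simp only [inner_sub_left, inner_sub_right] at hv ⊢
      linarith [real_inner_comm v (g x), real_inner_comm x (g x), real_inner_comm (g v) (g x)]
    have := mul_nonpos_of_nonneg_of_nonpos (hL a List.mem_cons_self).le hgap
    simp only [gapSum]
    linarith

theorem phi_quadratic {x y : ℝ} (hx : 0 ≤ x) (hy : 0 ≤ y) :
    phi x y ^ 2 + phi x y * (x + y) = x * y + 2 * x + 2 * y + 2 := by
  have := Real.sq_sqrt (show 0 ≤ (x + y + 2) ^ 2 + 4 * (x + 1) * (y + 1) by positivity)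
  unfold phi
  linear_combination this / 4

theorem one_le_phi {x y : ℝ} (hx : 0 ≤ x) (hy : 0 ≤ y) : 1 ≤ phi x y := by
  have : x + y + 2 ≤ Real.sqrt ((x + y + 2) ^ 2 + 4 * (x + 1) * (y + 1)) :=
    Real.le_sqrt_of_sq_le (by nlinarith [mul_nonneg hx hy])
  unfold phi
  linarith

theorem phi_lt {x y : ℝ} (hx : 0 ≤ x) (hy : 0 ≤ y) : phi x y < y + 2 := by
  have : Real.sqrt ((x + y + 2) ^ 2 + 4 * (x + 1) * (y + 1)) < x + 3 * y + 4 :=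
    (Real.sqrt_lt' (by positivity)).2 (by nlinarith [mul_nonneg hx hy])
  unfold phi
  linarith

/-- The decrease of `f` over the join step followed by the schedule `r`. -/
theorem PrimitiveFor.join_decrease (h : Interpolable f g) {r : List ℝ}
    (hr : PrimitiveFor f g r) (hpos : ∀ b ∈ r, 0 < b) {A : ℝ} (hA : 0 ≤ A) (u : E) :
    (A + phi A r.sum + 2 * r.sum + 1) / 2
          * ‖g (gdIter g (u - phi A r.sum • g u) r)‖ ^ 2
        + (phi A r.sum - A - 1) / 2 * ‖g u‖ ^ 2
      ≤ f u - f (gdIter g (u - phi A r.sum • g u) r) := by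
  have hB : 0 ≤ r.sum := List.sum_nonneg fun b hb => (hpos b hb).le
  have hquad := phi_quadratic hA hB
  have hone := one_le_phi hA hB
  have hlt := phi_lt hA hB
  set B := r.sum with hBdef
  set α := phi A B
  set y := u - α • g u with hy
  set z := gdIter g y r with hz
  have hru := hr (u - g u) (f u - 2⁻¹ * ‖g u‖ ^ 2) y
  have hrz := hr (z - g z) (f z - 2⁻¹ * ‖g z‖ ^ 2) y
  have hgu := h.gapSum_nonpos hpos u y
  have hgz := h.gapSum_nonpos hpos z y
  have huz := h u z
  have hzu := mul_le_mul_of_nonneg_left (h z u) (sub_nonneg.2 hone)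
  obtain ⟨D, hD⟩ : ∃ D, z = u - α • g u + D := ⟨z - y, by simp [hy]⟩
  have e1 : z - (u - g u) = (1 - α) • g u + D := by rw [hD]; module
  have e2 : y - (u - g u) = (1 - α) • g u := by rw [hy]; module
  have e3 : z - (z - g z) = g z := by module
  have e4 : y - (z - g z) = g z - D := by rw [hy, hD]; module
  have e5 : u - z = α • g u - D := by rw [hD]; module
  have e6 : z - u = D - α • g u := by rw [hD]; module
  rw [← hBdef, ← hz, e1, e2] at hru
  rw [← hBdef, ← hz, e3, e4] at hrz
  rw [e5] at huz
  rw [e6] at hzu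
  simp only [norm_add_sq_real, norm_sub_sq_real, norm_smul, mul_pow, inner_sub_right,
    real_inner_smul_left, real_inner_smul_right, Real.norm_eq_abs, sq_abs,
    real_inner_self_eq_norm_sq] at hru hrz huz hzu
  rw [real_inner_comm (g u) (g z)] at huz hzu
  refine le_of_mul_le_mul_left ?_ (sub_pos.2 hlt)
  linear_combination hru + hrz + huz + hzu + hgu + hgz
    + (2⁻¹ * ‖g u‖ ^ 2 - 2⁻¹ * ‖g z‖ ^ 2) * hquad

theorem PrimitiveFor.concat (h : Interpolable f g) {s r : List ℝ}
    (hs : PrimitiveFor f g s) (hr : PrimitiveFor f g r)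
    (hspos : ∀ a ∈ s, 0 < a) (hrpos : ∀ b ∈ r, 0 < b) :
    PrimitiveFor f g (concatSched s r) := by
  intro w F x
  have hA : 0 ≤ s.sum := List.sum_nonneg fun b hb => (hspos b hb).le
  have hB : 0 ≤ r.sum := List.sum_nonneg fun b hb => (hrpos b hb).le
  have hone := one_le_phi hA hB
  have hws := hs w F x
  set u := gdIter g x s with hu
  have hdec := mul_le_mul_of_nonneg_left (hr.join_decrease h hrpos hA u)
    (show 0 ≤ s.sum + phi s.sum r.sum by linarith)
  have hwr := hr w F (u - phi s.sum r.sum • g u)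
  simp only [concatSched, gdIter_append, gapSum_append, gdIter, gapSum, List.sum_append,
    List.sum_cons, ← hu]
  set α := phi s.sum r.sum
  have e : u - α • g u - w = (u - w) - α • g u := by module
  rw [e, norm_sub_sq_real (u - w)] at hwr
  simp only [norm_smul, mul_pow, real_inner_smul_right, Real.norm_eq_abs, sq_abs] at hwr
  rw [real_inner_comm] at hwr
  nlinarith

theorem concatSched_pos {s r : List ℝ} (hs : ∀ a ∈ s, 0 < a) (hr : ∀ b ∈ r, 0 < b) :
    ∀ a ∈ concatSched s r, 0 < a := by
  have := one_le_phi (List.sum_nonneg fun b hb => (hs b hb).le)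
    (List.sum_nonneg fun b hb => (hr b hb).le)
  intro a ha
  simp only [concatSched, List.mem_append, List.mem_cons] at ha
  rcases ha with ha | rfl | ha
  · exact hs a ha
  · linarith
  · exact hr a ha

theorem silver_pos (i : ℕ) : ∀ a ∈ silver i, 0 < a := by
  induction i with
  | zero => simp [silver]
  | succ i ih => exact concatSched_pos ih ih

theorem primitiveFor_silver (h : Interpolable f g) (i : ℕ) : PrimitiveFor f g (silver i) := by
  induction i with
  | zero => intro w F x; simp [silver, gdIter, gapSum]
  | succ i ih => exact ih.concat h ih (silver_pos i) (silver_pos i)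

theorem phi_self {x : ℝ} (hx : 0 ≤ x) : phi x x = Real.sqrt 2 * (x + 1) - x := by
  have : (x + x + 2) ^ 2 + 4 * (x + 1) * (x + 1) = 2 * (2 * (x + 1)) ^ 2 := by ring
  rw [phi, this, Real.sqrt_mul zero_le_two, Real.sqrt_sq (by positivity)]
  ring

theorem sum_silver (i : ℕ) : (silver i).sum = (1 + Real.sqrt 2) ^ i - 1 := by
  induction i with
  | zero => simp [silver]
  | succ i ih =>
    have hpos : 0 ≤ (silver i).sum := List.sum_nonneg fun b hb => (silver_pos i b hb).le
    simp only [silver, concatSched, List.sum_append, List.sum_cons]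
    rw [phi_self hpos, ih]
    ring

end Composition

section Smooth

variable {E : Type*} [NormedAddCommGroup E] [InnerProductSpace ℝ E] [CompleteSpace E]
  {f : E → ℝ} {g : E → E}

theorem hasDerivAt_comp_line (hgrad : ∀ y, HasGradientAt f (g y) y) (x v : E) (t : ℝ) :
    HasDerivAt (fun t : ℝ => f (x + t • v)) ⟪g (x + t • v), v⟫ t := by
  have hline : HasDerivAt (fun t : ℝ => x + t • v) v t := by
    simpa using ((hasDerivAt_id t).smul_const v).const_add x
  simpa [Function.comp_def] using (hgrad (x + t • v)).hasFDerivAt.comp_hasDerivAt t hline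

theorem le_add_inner_add_sq_of_lipschitz (hgrad : ∀ y, HasGradientAt f (g y) y)
    (hlip : LipschitzWith 1 g) (x v : E) :
    f (x + v) ≤ f x + ⟪g x, v⟫ + 2⁻¹ * ‖v‖ ^ 2 := by
  have hder (t : ℝ) :
      HasDerivAt (fun t : ℝ => f (x + t • v) - t * ⟪g x, v⟫ - t ^ 2 * (2⁻¹ * ‖v‖ ^ 2))
        (⟪g (x + t • v), v⟫ - ⟪g x, v⟫ - t * ‖v‖ ^ 2) t := by
    have := ((hasDerivAt_comp_line hgrad x v t).sub
      ((hasDerivAt_id t).mul_const ⟪g x, v⟫)).sub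
      (((hasDerivAt_id t).pow 2).mul_const (2⁻¹ * ‖v‖ ^ 2))
    refine this.congr_deriv ?_
    simp
    ring
  have hanti := antitoneOn_of_deriv_nonpos (convex_Icc (0 : ℝ) 1)
    (fun t _ => (hder t).continuousAt.continuousWithinAt)
    (fun t _ => (hder t).differentiableAt.differentiableWithinAt) fun t ht => by
      rw [interior_Icc] at ht
      rw [(hder t).deriv, ← inner_sub_left]
      have h1 := real_inner_le_norm (g (x + t • v) - g x) v
      have h2 : ‖g (x + t • v) - g x‖ ≤ t * ‖v‖ := by
        simpa [norm_smul, abs_of_pos ht.1] using hlip.norm_sub_le (x + t • v) x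
      nlinarith [norm_nonneg v]
  have := hanti (Set.left_mem_Icc.2 zero_le_one) (Set.right_mem_Icc.2 zero_le_one) zero_le_one
  simp at this
  linarith

theorem add_inner_le_of_convexOn (hconv : ConvexOn ℝ Set.univ f)
    (hgrad : ∀ y, HasGradientAt f (g y) y) (x y : E) :
    f y + ⟪g y, x - y⟫ ≤ f x := by
  have hline : ConvexOn ℝ Set.univ (fun t : ℝ => f (y + t • (x - y))) := by
    have := hconv.comp_affineMap (AffineMap.lineMap y x : ℝ →ᵃ[ℝ] E)
    simpa [Function.comp_def, AffineMap.lineMap_apply, add_comm] using this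
  have hder := hasDerivAt_comp_line hgrad y (x - y) 0
  have := hline.le_slope_of_hasDerivAt (Set.mem_univ 0) (Set.mem_univ 1) zero_lt_one hder
  simp [slope] at this
  linarith

theorem interpolable_of_convexOn_of_lipschitz (hconv : ConvexOn ℝ Set.univ f)
    (hgrad : ∀ y, HasGradientAt f (g y) y) (hlip : LipschitzWith 1 g) :
    Interpolable f g := by
  intro x y
  have h1 := le_add_inner_add_sq_of_lipschitz hgrad hlip x (-(g x - g y))
  have h2 := add_inner_le_of_convexOn hconv hgrad (x + -(g x - g y)) y
  have e : x + -(g x - g y) - y = (x - y) - (g x - g y) := by abel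
  rw [e, inner_sub_right (g y)] at h2
  rw [norm_neg, inner_neg_right] at h1
  have h3 : ⟪g x, g x - g y⟫ - ⟪g y, g x - g y⟫ = ‖g x - g y‖ ^ 2 := by
    rw [← inner_sub_left, real_inner_self_eq_norm_sq]
  linarith

end Smooth

/-- last-iterate convergence of the `i`-th silver stepsize
schedule: `f(x_{2^i}) − f* ≤ ‖x₁ − x*‖²/(2(ρ^i − 1))` with `ρ = 1 + √2`. -/
theorem silver_convergence (i : ℕ) (hi : 1 ≤ i)
    (d : ℕ) (f : EuclideanSpace ℝ (Fin d) → ℝ)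
    (g : EuclideanSpace ℝ (Fin d) → EuclideanSpace ℝ (Fin d))
    (hconv : ConvexOn ℝ Set.univ f)
    (hgrad : ∀ y, HasGradientAt f (g y) y)
    (hlip : LipschitzWith 1 g)
    (xstar : EuclideanSpace ℝ (Fin d)) (hmin : IsMinOn f Set.univ xstar)
    (x1 : EuclideanSpace ℝ (Fin d)) :
    f (gdIter g x1 (silver i)) - f xstar ≤
      ‖x1 - xstar‖ ^ 2 / (2 * ((1 + Real.sqrt 2) ^ i - 1)) := by
  have hf := interpolable_of_convexOn_of_lipschitz hconv hgrad hlip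
  have hstar : g xstar = 0 := by
    have hfd := (hmin.isLocalMin Filter.univ_mem).hasFDerivAt_eq_zero (hgrad xstar).hasFDerivAt
    simpa using hfd
  have hprim := primitiveFor_silver hf i xstar (f xstar) x1
  have hgap := hf.gapSum_nonpos (silver_pos i) xstar x1
  simp only [hstar, sub_zero, norm_zero, ne_eq, OfNat.ofNat_ne_zero, not_false_eq_true,
    zero_pow, mul_zero] at hgap
  rw [sum_silver] at hprim
  have hpos : 0 < (1 + Real.sqrt 2) ^ i - 1 :=
    sub_pos.2 (one_lt_pow₀ (by simp) (Nat.one_le_iff_ne_zero.1 hi))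
  rw [le_div_iff₀ (by positivity)]
  have : 0 ≤ ((1 + Real.sqrt 2) ^ i - 1) * ((1 + Real.sqrt 2) ^ i - 1 + 1) / 2
      * ‖g (gdIter g x1 (silver i))‖ ^ 2 := by positivity
  nlinarith [sq_nonneg ‖gdIter g x1 (silver i) - xstar‖]
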